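/- Stationarity conditions for the free-energy minimizer over Gaussians: Define the free energy of a Gaussian N(m,Σ) by F(m,Σ) = ∫ U dN(m,Σ) − (1/2)·log((2πe)^d · det Σ), for m ∈ ℝ^d and Σ positive definite. If (m_*, Σ_*) minimizes F over all m ∈ ℝ^d and all positive-definite Σ, then ∫ ∇U dN(m_*,Σ_*) = 0 and ∫ ∇²U dN(m_*,Σ_*) = Σ_*^{-1}. -/

import Mathlib

open MeasureTheory Matrix Real
open scoped RealInnerProductSpace

noncomputable section

/-- `ℝ^d` as a Euclidean space. -/
abbrev Vec (d : ℕ) := EuclideanSpace ℝ (Fin d)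

/-- `d × d` real matrices. -/
abbrev Mat (d : ℕ) := Matrix (Fin d) (Fin d) ℝ

variable {d : ℕ}

/-- Matrix-vector product as a map on Euclidean space. -/
def matVec (A : Mat d) (x : Vec d) : Vec d :=
  (EuclideanSpace.equiv (Fin d) ℝ).symm (A.mulVec (EuclideanSpace.equiv (Fin d) ℝ x))

/-- The Gaussian measure `N(m, S)` on `ℝ^d` with mean `m` and covariance `S`,
defined via its density with respect to Lebesgue measure.  (For `S` positive
definite this is the usual Gaussian probability measure.) -/
def gaussian (m : Vec d) (S : Mat d) : Measure (Vec d) :=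
  volume.withDensity fun x =>
    ENNReal.ofReal (Real.sqrt (((2 * π) ^ d * S.det)⁻¹) *
      Real.exp (-⟪x - m, matVec S⁻¹ (x - m)⟫ / 2))

/-- The Hessian of `f : ℝ^d → ℝ` at `x`, as a `d × d` matrix. -/
def hess (f : Vec d → ℝ) (x : Vec d) : Mat d :=
  Matrix.of fun i j =>
    fderiv ℝ (fun y => fderiv ℝ f y (EuclideanSpace.single j 1)) x (EuclideanSpace.single i 1)

/-- Frobenius norm of a matrix. -/
def frobNorm (A : Mat d) : ℝ := Real.sqrt (∑ i, ∑ j, (A i j) ^ 2)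

/-- Squared Frobenius norm of a matrix. -/
def frobSq (A : Mat d) : ℝ := ∑ i, ∑ j, (A i j) ^ 2

/-- Jacobian of `g : ℝ^d → ℝ^d` at `x`: `(jacobian g x) i j = ∂ g_j / ∂ x_i`. -/
def jacobian (g : Vec d → Vec d) (x : Vec d) : Mat d :=
  Matrix.of fun i j => fderiv ℝ (fun y => g y j) x (EuclideanSpace.single i 1)

/-- Integral of the gradient of `U` against a measure. -/
def intGrad (U : Vec d → ℝ) (q : Measure (Vec d)) : Vec d := ∫ x, gradient U x ∂q

/-- Entrywise integral of the Hessian of `U` against a measure. -/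
def intHess (U : Vec d → ℝ) (q : Measure (Vec d)) : Mat d :=
  Matrix.of fun i j => ∫ x, hess U x i j ∂q

/-- The variational free energy of the Gaussian `N(m,S)`:
`F(m,Σ) = ∫ U dN(m,Σ) − (1/2)·log((2πe)^d · det Σ)`. -/
def freeEnergy (U : Vec d → ℝ) (m : Vec d) (S : Mat d) : ℝ :=
  (∫ x, U x ∂(gaussian m S)) - (1 / 2) * Real.log ((2 * π * Real.exp 1) ^ d * S.det)

lemma matVec_eq_toEuclideanCLM (A : Mat d) (x : Vec d) :
    matVec A x = Matrix.toEuclideanCLM (𝕜 := ℝ) A x := rfl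

lemma inner_matVec (A : Mat d) (x y : Vec d) :
    ⟪x, matVec A y⟫ = x.ofLp ⬝ᵥ A *ᵥ y.ofLp :=
  Matrix.inner_toEuclideanCLM A x y

lemma continuous_matVec (A : Mat d) : Continuous (matVec A) :=
  (Matrix.toEuclideanCLM (𝕜 := ℝ) A).continuous

lemma matVec_mul (A B : Mat d) (x : Vec d) : matVec (A * B) x = matVec A (matVec B x) := by
  simp only [matVec_eq_toEuclideanCLM, map_mul]
  rfl

lemma matVec_one (x : Vec d) : matVec 1 x = x := by
  simp [matVec_eq_toEuclideanCLM]

lemma det_toEuclideanCLM (A : Mat d) : (Matrix.toEuclideanCLM (𝕜 := ℝ) A).det = A.det := by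
  rw [ContinuousLinearMap.det, Matrix.coe_toEuclideanCLM_eq_toEuclideanLin,
    Matrix.toEuclideanLin_eq_toLin_orthonormal, LinearMap.det_toLin]

/-- A positive definite quadratic form on `ℝ^d` is bounded below by a multiple of `‖·‖²`. -/
lemma Matrix.PosDef.exists_le_inner_matVec {P : Mat d} (hP : P.PosDef) :
    ∃ c > 0, ∀ y : Vec d, c * ‖y‖ ^ 2 ≤ ⟪y, matVec P y⟫ := by
  rcases (Metric.sphere (0 : Vec d) 1).eq_empty_or_nonempty with h | h
  · refine ⟨1, one_pos, fun y => ?_⟩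
    have hy : y = 0 := by
      by_contra hy
      have : (‖y‖⁻¹ • y) ∈ Metric.sphere (0 : Vec d) 1 := by
        simp [norm_smul, norm_ne_zero_iff.2 hy]
      simp [h] at this
    simp [hy]
  · obtain ⟨z, hz, hmin⟩ := (isCompact_sphere (0 : Vec d) 1).exists_isMinOn h
      (f := fun y => ⟪y, matVec P y⟫) (continuous_id.inner (continuous_matVec P)).continuousOn
    have hz0 : z ≠ 0 := by
      rintro rfl
      simp at hz
    refine ⟨⟪z, matVec P z⟫, ?_, fun y => ?_⟩
    · rw [inner_matVec]
      exact hP.dotProduct_mulVec_pos (x := z.ofLp) (by simpa using hz0)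
    · by_cases hy : y = 0
      · simp [hy]
      have hn : ‖y‖ ≠ 0 := norm_ne_zero_iff.2 hy
      have := isMinOn_iff.1 hmin (‖y‖⁻¹ • y) (by simp [norm_smul, hn])
      simp only [matVec_eq_toEuclideanCLM, map_smul, inner_smul_left, inner_smul_right] at this ⊢
      rw [conj_trivial, ← mul_assoc] at this
      have h2 := mul_le_mul_of_nonneg_right this (sq_nonneg ‖y‖)
      refine h2.trans_eq ?_
      field_simp

/-- The density of `gaussian m S`. -/
def gaussianDensity (m : Vec d) (S : Mat d) (x : Vec d) : ℝ :=
  √(((2 * π) ^ d * S.det)⁻¹) * Real.exp (-⟪x - m, matVec S⁻¹ (x - m)⟫ / 2)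

lemma gaussianDensity_nonneg (m : Vec d) (S : Mat d) (x : Vec d) : 0 ≤ gaussianDensity m S x := by
  unfold gaussianDensity
  positivity

lemma continuous_gaussianDensity (m : Vec d) (S : Mat d) : Continuous (gaussianDensity m S) := by
  have h := continuous_matVec S⁻¹
  unfold gaussianDensity
  fun_prop

lemma integral_gaussian_eq_integral_density {E : Type*} [NormedAddCommGroup E] [NormedSpace ℝ E]
    (m : Vec d) (S : Mat d) (f : Vec d → E) :
    ∫ x, f x ∂(gaussian m S) = ∫ x, gaussianDensity m S x • f x := by
  have hm : Measurable fun x => ENNReal.ofReal (gaussianDensity m S x) :=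
    (continuous_gaussianDensity m S).measurable.ennreal_ofReal
  refine (integral_withDensity_eq_integral_toReal_smul hm (by simp) f).trans ?_
  simp [ENNReal.toReal_ofReal, gaussianDensity_nonneg]

lemma integrable_exp_neg_mul_norm_sub_sq {c : ℝ} (hc : 0 < c) (m : Vec d) :
    Integrable fun x : Vec d => Real.exp (-c * ‖x - m‖ ^ 2) := by
  have h := (GaussianFourier.integrable_cexp_neg_mul_sq_norm_add (V := Vec d) (b := (c : ℂ))
    (by simpa using hc) 0 0).norm
  have h' : Integrable fun x : Vec d => Real.exp (-c * ‖x‖ ^ 2) := by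
    refine h.congr (.of_forall fun x => ?_)
    simp only [Complex.norm_exp]
    congr 1
    rw [zero_mul, add_zero]
    norm_cast
  exact h'.comp_sub_right m

lemma integrable_gaussianDensity_mul_quadratic (m : Vec d) {S : Mat d} (hS : S.PosDef) :
    Integrable fun x => gaussianDensity m S x * (1 + ‖x - m‖ ^ 2) := by
  obtain ⟨c, hc, hle⟩ := hS.inv.exists_le_inner_matVec
  set K := √(((2 * π) ^ d * S.det)⁻¹)
  refine ((integrable_exp_neg_mul_norm_sub_sq (c := c / 4) (by positivity) m).const_mul
    (K * (1 + 4 / c))).mono' ?_ (.of_forall fun x => ?_)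
  · exact ((continuous_gaussianDensity m S).mul (by fun_prop)).aestronglyMeasurable
  · rw [Real.norm_of_nonneg (mul_nonneg (gaussianDensity_nonneg m S x) (by positivity))]
    have hx := hle (x - m)
    set r := ‖x - m‖ ^ 2
    have hr : 0 ≤ r := sq_nonneg _
    have hexp : 1 + r ≤ (1 + 4 / c) * Real.exp (c / 4 * r) := by
      have h1 := Real.add_one_le_exp (c / 4 * r)
      have h2 : (1 + 4 / c) * (c / 4 * r + 1) = 1 + r + (c / 4 * r + 4 / c) := by
        field_simp
        ring
      have h3 : 0 ≤ c / 4 * r + 4 / c := by positivity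
      nlinarith [mul_le_mul_of_nonneg_left h1 (by positivity : 0 ≤ 1 + 4 / c)]
    calc gaussianDensity m S x * (1 + r)
        ≤ (K * Real.exp (-(c * r) / 2)) * ((1 + 4 / c) * Real.exp (c / 4 * r)) := by
          unfold gaussianDensity
          gcongr
      _ = K * (1 + 4 / c) * Real.exp (-(c / 4) * r) := by
          rw [mul_mul_mul_comm, ← Real.exp_add]
          congr 2
          ring

lemma integrable_gaussianDensity_smul {E : Type*} [NormedAddCommGroup E] [NormedSpace ℝ E]
    {m : Vec d} {S : Mat d} (hS : S.PosDef) {f : Vec d → E} (hf : Continuous f) {K : ℝ}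
    (hK : ∀ x, ‖f x‖ ≤ K * (1 + ‖x - m‖ ^ 2)) :
    Integrable fun x => gaussianDensity m S x • f x := by
  refine ((integrable_gaussianDensity_mul_quadratic m hS).const_mul K).mono'
    ((continuous_gaussianDensity m S).smul hf).aestronglyMeasurable (.of_forall fun x => ?_)
  rw [norm_smul, Real.norm_of_nonneg (gaussianDensity_nonneg m S x), mul_left_comm]
  exact mul_le_mul_of_nonneg_left (hK x) (gaussianDensity_nonneg m S x)

lemma abs_det_mul_gaussianDensity_affine (m m' : Vec d) (S : Mat d) {B : Mat d}
    (hB : B.det ≠ 0) (x : Vec d) :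
    |B.det| * gaussianDensity m' (B * S * Bᵀ) (m' + matVec B (x - m)) = gaussianDensity m S x := by
  have hBu : IsUnit B.det := hB.isUnit
  have hquad (y : Vec d) :
      ⟪matVec B y, matVec (B * S * Bᵀ)⁻¹ (matVec B y)⟫ = ⟪y, matVec S⁻¹ y⟫ := by
    have h1 : matVec (B * S * Bᵀ)⁻¹ (matVec B y) = matVec ((Bᵀ)⁻¹ * S⁻¹) y := by
      rw [← matVec_mul, Matrix.mul_inv_rev, Matrix.mul_inv_rev, Matrix.mul_assoc, Matrix.mul_assoc,
        Matrix.nonsing_inv_mul B hBu, Matrix.mul_one]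
    rw [h1, inner_matVec, inner_matVec]
    change (B *ᵥ y.ofLp) ⬝ᵥ _ = _
    rw [← Matrix.vecMul_transpose, ← Matrix.dotProduct_mulVec, Matrix.mulVec_mulVec,
      ← Matrix.mul_assoc, Matrix.mul_nonsing_inv _ (by simpa using hBu), Matrix.one_mul]
  unfold gaussianDensity
  rw [add_sub_cancel_left, hquad, ← mul_assoc]
  congr 1
  rw [Matrix.det_mul, Matrix.det_mul, Matrix.det_transpose, ← Real.sqrt_sq_eq_abs,
    ← Real.sqrt_mul (sq_nonneg _)]
  congr 1
  rw [show (2 * π) ^ d * (B.det * S.det * B.det) = B.det ^ 2 * ((2 * π) ^ d * S.det) by ring,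
    mul_inv, ← mul_assoc, mul_inv_cancel₀ (pow_ne_zero 2 hB), one_mul]

/-- The affine map `x ↦ m' + B (x - m)` carries `N(m, S)` to `N(m', B S Bᵀ)`. -/
lemma integral_gaussian_affine {E : Type*} [NormedAddCommGroup E] [NormedSpace ℝ E]
    (m m' : Vec d) (S : Mat d) {B : Mat d} (hB : B.det ≠ 0) (f : Vec d → E) :
    ∫ x, f x ∂(gaussian m' (B * S * Bᵀ)) = ∫ x, f (m' + matVec B (x - m)) ∂(gaussian m S) := by
  set T : Vec d → Vec d := fun x => m' + matVec B (x - m)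
  have hT (x : Vec d) : HasFDerivAt T (Matrix.toEuclideanCLM (𝕜 := ℝ) B) x :=
    (((Matrix.toEuclideanCLM (𝕜 := ℝ) B).hasFDerivAt.comp x
      ((hasFDerivAt_id x).sub_const m)).const_add m')
  have hinv (x : Vec d) : matVec B⁻¹ (matVec B x) = x := by
    rw [← matVec_mul, Matrix.nonsing_inv_mul B hB.isUnit, matVec_one]
  have hinv' (x : Vec d) : matVec B (matVec B⁻¹ x) = x := by
    rw [← matVec_mul, Matrix.mul_nonsing_inv B hB.isUnit, matVec_one]
  have hinj : Function.Injective T := fun x y hxy => by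
    simpa [hinv] using congrArg (matVec B⁻¹) (add_left_cancel hxy)
  have hsurj : Function.Surjective T := fun y =>
    ⟨m + matVec B⁻¹ (y - m'), by simp [T, hinv']⟩
  have key := integral_image_eq_integral_abs_det_fderiv_smul volume MeasurableSet.univ
    (fun x _ => (hT x).hasFDerivWithinAt) hinj.injOn
    (fun x => gaussianDensity m' (B * S * Bᵀ) x • f x)
  rw [Set.image_univ, hsurj.range_eq, setIntegral_univ, setIntegral_univ] at key
  rw [integral_gaussian_eq_integral_density, integral_gaussian_eq_integral_density, key]
  refine integral_congr_ae (.of_forall fun x => ?_)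
  simp only [smul_smul, det_toEuclideanCLM]
  rw [abs_det_mul_gaussianDensity_affine m m' S hB]

lemma Matrix.PosSemidef.abs_apply_le {n : Type*} [Fintype n] [DecidableEq n]
    {P : Matrix n n ℝ} (hP : P.PosSemidef) (i j : n) : |P i j| ≤ (P i i + P j j) / 2 := by
  have hsymm : P j i = P i j := by simpa using hP.isHermitian.apply i j
  have h1 := hP.dotProduct_mulVec_nonneg (Pi.single i 1 + Pi.single j 1)
  have h2 := hP.dotProduct_mulVec_nonneg (Pi.single i 1 - Pi.single j 1)
  simp [Matrix.mulVec_add, Matrix.mulVec_sub, add_dotProduct, sub_dotProduct] at h1 h2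
  rw [abs_le]
  constructor <;> linarith

/-- A matrix squeezed between `μ I` and `L I` has entries bounded by `L`. -/
lemma abs_apply_le_of_loewner_bounds {n : Type*} [Fintype n] [DecidableEq n]
    {H : Matrix n n ℝ} {μ L : ℝ} (hμ : 0 ≤ μ) (hlow : (H - μ • 1).PosSemidef)
    (hup : (L • 1 - H).PosSemidef) (i j : n) : |H i j| ≤ L := by
  have hdiag (k : n) : H k k ≤ L := by simpa using hup.diag_nonneg (i := k)
  have h := hlow.abs_apply_le i j
  simp only [Matrix.sub_apply, Matrix.smul_apply, Matrix.one_apply_eq, smul_eq_mul] at h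
  have h1 : |μ * (1 : Matrix n n ℝ) i j| ≤ μ := by
    rw [Matrix.one_apply]
    split_ifs <;> simp [abs_of_nonneg hμ, hμ]
  have h2 := abs_add_le (H i j - μ * (1 : Matrix n n ℝ) i j) (μ * (1 : Matrix n n ℝ) i j)
  rw [sub_add_cancel] at h2
  linarith [hdiag i, hdiag j]

lemma opNorm_le_of_apply_single_le {F : Type*} [NormedAddCommGroup F] [NormedSpace ℝ F]
    {φ : Vec d →L[ℝ] F} {K : ℝ} (hK : 0 ≤ K)
    (h : ∀ i, ‖φ (EuclideanSpace.single i 1)‖ ≤ K) : ‖φ‖ ≤ d * K := by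
  refine φ.opNorm_le_bound (by positivity) fun x => ?_
  have hx : x = ∑ i, x i • EuclideanSpace.single i (1 : ℝ) := by
    simpa using ((EuclideanSpace.basisFun (Fin d) ℝ).sum_repr x).symm
  calc ‖φ x‖ = ‖∑ i, x i • φ (EuclideanSpace.single i 1)‖ := by
        conv_lhs => rw [hx]
        simp
    _ ≤ ∑ _i : Fin d, ‖x‖ * K := by
        refine norm_sum_le_of_le _ fun i _ => ?_
        rw [norm_smul]
        exact mul_le_mul (PiLp.norm_apply_le x i) (h i) (norm_nonneg _) (norm_nonneg _)
    _ = d * K * ‖x‖ := by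
        simp
        ring

section Growth

variable {U : Vec d → ℝ}

lemma contDiff_fderiv_apply (hU : ContDiff ℝ 2 U) (v : Vec d) :
    ContDiff ℝ 1 fun x => fderiv ℝ U x v :=
  (hU.fderiv_right (m := 1) (by norm_num)).clm_apply contDiff_const

lemma continuous_hess (hU : ContDiff ℝ 2 U) (i j : Fin d) : Continuous fun x => hess U x i j :=
  ((contDiff_fderiv_apply hU _).continuous_fderiv (by norm_num)).clm_apply continuous_const

lemma exists_norm_fderiv_le (hU : ContDiff ℝ 2 U) {L : ℝ}
    (hess_le : ∀ x i j, |hess U x i j| ≤ L) (m : Vec d) :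
    ∃ K, 0 ≤ K ∧ ∀ x, ‖fderiv ℝ U x‖ ≤ K * (1 + ‖x - m‖) := by
  have habs (x : Vec d) (i j : Fin d) : |hess U x i j| ≤ |L| := (hess_le x i j).trans (le_abs_self L)
  have hpartial (x : Vec d) (j : Fin d) :
      ‖fderiv ℝ U x (EuclideanSpace.single j 1) - fderiv ℝ U m (EuclideanSpace.single j 1)‖
        ≤ d * |L| * ‖x - m‖ :=
    convex_univ.norm_image_sub_le_of_norm_fderiv_le
      (f := fun y => fderiv ℝ U y (EuclideanSpace.single j 1))
      (fun y _ => ((contDiff_fderiv_apply hU _).differentiable (by norm_num)) y)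
      (fun y _ => opNorm_le_of_apply_single_le (abs_nonneg L) fun i => habs y i j)
      (Set.mem_univ m) (Set.mem_univ x)
  refine ⟨‖fderiv ℝ U m‖ + d * (d * |L|), by positivity, fun x => ?_⟩
  have h1 : ‖fderiv ℝ U x - fderiv ℝ U m‖ ≤ d * (d * |L| * ‖x - m‖) :=
    opNorm_le_of_apply_single_le (by positivity) fun j => hpartial x j
  have h2 := norm_le_norm_add_norm_sub' (fderiv ℝ U x) (fderiv ℝ U m)
  have h3 : 0 ≤ ‖fderiv ℝ U m‖ * ‖x - m‖ := by positivity
  have h4 : 0 ≤ (d : ℝ) * (d * |L|) := by positivity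
  linarith

lemma exists_norm_le_of_norm_fderiv_le (hU : Differentiable ℝ U) {m : Vec d} {K : ℝ} (hK : 0 ≤ K)
    (h : ∀ x, ‖fderiv ℝ U x‖ ≤ K * (1 + ‖x - m‖)) :
    ∃ K', ∀ x, ‖U x‖ ≤ K' * (1 + ‖x - m‖ ^ 2) := by
  refine ⟨‖U m‖ + 2 * K, fun x => ?_⟩
  have h1 : ‖U x - U m‖ ≤ K * (1 + ‖x - m‖) * ‖x - m‖ := by
    refine (convex_closedBall m ‖x - m‖).norm_image_sub_le_of_norm_fderiv_le
      (fun y _ => hU y) (fun y hy => (h y).trans ?_) (by simp) (by simp [dist_eq_norm])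
    rw [mem_closedBall_iff_norm] at hy
    gcongr
  have h2 := norm_le_norm_add_norm_sub' (U x) (U m)
  have h3 : 0 ≤ ‖U m‖ * ‖x - m‖ ^ 2 := by positivity
  nlinarith [mul_nonneg hK (sq_nonneg (‖x - m‖ - 1)), mul_nonneg hK (sq_nonneg ‖x - m‖)]

/-- First variation of `∫ U dN(m, S)` along a transport direction `w` of linear growth. -/
lemma hasDerivAt_integral_gaussian (hU : ContDiff ℝ 1 U) {m : Vec d} {S : Mat d} (hS : S.PosDef)
    {K C : ℝ} (hK : 0 ≤ K) (hC : 0 ≤ C) (hgrad : ∀ x, ‖fderiv ℝ U x‖ ≤ K * (1 + ‖x - m‖))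
    {w : Vec d → Vec d} (hw : Continuous w) (hwC : ∀ x, ‖w x‖ ≤ C * (1 + ‖x - m‖)) :
    HasDerivAt (fun t : ℝ => ∫ x, U (x + t • w x) ∂(gaussian m S))
      (∫ x, fderiv ℝ U x (w x) ∂(gaussian m S)) 0 := by
  have hdiff : Differentiable ℝ U := hU.differentiable (by norm_num)
  have hfd : Continuous (fderiv ℝ U) := hU.continuous_fderiv (by norm_num)
  obtain ⟨K', hK'⟩ := exists_norm_le_of_norm_fderiv_le hdiff hK hgrad
  have hρ := continuous_gaussianDensity m S
  simp only [integral_gaussian_eq_integral_density]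
  have key := hasDerivAt_integral_of_dominated_loc_of_deriv_le (μ := (volume : Measure (Vec d)))
    (F := fun (t : ℝ) x => gaussianDensity m S x • U (x + t • w x))
    (F' := fun (t : ℝ) x => gaussianDensity m S x • fderiv ℝ U (x + t • w x) (w x))
    (x₀ := 0) (s := Metric.ball 0 1)
    (bound := fun x => 2 * K * (1 + C) * C * (gaussianDensity m S x * (1 + ‖x - m‖ ^ 2)))
    (Metric.ball_mem_nhds 0 one_pos) (.of_forall fun t => ?_) ?_ ?_
    (.of_forall fun x t ht => ?_) ((integrable_gaussianDensity_mul_quadratic m hS).const_mul _)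
    (.of_forall fun x t _ => ?_)
  · simpa using key.2
  · exact (hρ.smul (hU.continuous.comp (by fun_prop))).aestronglyMeasurable
  · simpa using integrable_gaussianDensity_smul hS hU.continuous hK'
  · exact (hρ.smul ((hfd.comp (by fun_prop)).clm_apply hw)).aestronglyMeasurable
  · have ht' : |t| ≤ 1 := by simpa using (mem_ball_zero_iff.1 ht).le
    have hnorm : ‖x + t • w x - m‖ ≤ ‖x - m‖ + C * (1 + ‖x - m‖) := by
      rw [add_sub_right_comm]
      refine (norm_add_le _ _).trans (add_le_add_right ?_ _)
      rw [norm_smul]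
      exact (mul_le_of_le_one_left (norm_nonneg _) ht').trans (hwC x)
    have hbound : ‖fderiv ℝ U (x + t • w x) (w x)‖
        ≤ 2 * K * (1 + C) * C * (1 + ‖x - m‖ ^ 2) := by
      calc ‖fderiv ℝ U (x + t • w x) (w x)‖
          ≤ (K * (1 + (‖x - m‖ + C * (1 + ‖x - m‖)))) * (C * (1 + ‖x - m‖)) := by
            refine (ContinuousLinearMap.le_opNorm _ _).trans ?_
            refine mul_le_mul ((hgrad _).trans ?_) (hwC x) (norm_nonneg _) (by positivity)
            gcongr
        _ = K * (1 + C) * C * (1 + ‖x - m‖) ^ 2 := by ring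
        _ ≤ K * (1 + C) * C * (2 * (1 + ‖x - m‖ ^ 2)) := by
            gcongr
            nlinarith [sq_nonneg (‖x - m‖ - 1)]
        _ = _ := by ring
    rw [norm_smul, Real.norm_of_nonneg (gaussianDensity_nonneg m S x), mul_left_comm]
    exact mul_le_mul_of_nonneg_left hbound (gaussianDensity_nonneg m S x)
  · have h1 : HasDerivAt (fun t : ℝ => x + t • w x) (w x) t := by
      simpa using ((hasDerivAt_id t).smul_const (w x)).const_add x
    exact ((hdiff _).hasFDerivAt.comp_hasDerivAt t h1).const_smul (gaussianDensity m S x)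

end Growth

lemma hasDerivAt_det_one_add_smul {n : Type*} [Fintype n] [DecidableEq n] (H : Matrix n n ℝ) :
    HasDerivAt (fun t : ℝ => (1 + t • H).det) H.trace 0 := by
  rw [funext fun t : ℝ => Matrix.det_one_add_smul t H]
  have h1 : HasDerivAt (fun t : ℝ => 1 + H.trace * t) H.trace 0 := by
    simpa using ((hasDerivAt_id (0 : ℝ)).const_mul H.trace).const_add 1
  have h2 := ((1 + (Polynomial.X : Polynomial ℝ) • H.map ⇑Polynomial.C).det.divX.divX.hasDerivAt
    (0 : ℝ)).mul (hasDerivAt_pow 2 (0 : ℝ))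
  exact (h1.add h2).congr_deriv (by norm_num)

/-- Stationarity of the free energy along all affine perturbations of a minimizing Gaussian. -/
lemma integral_fderiv_affine_eq_trace {U : Vec d → ℝ} (hU : ContDiff ℝ 1 U)
    {m : Vec d} {S : Mat d} (hS : S.PosDef) {K : ℝ} (hK : 0 ≤ K)
    (hgrad : ∀ x, ‖fderiv ℝ U x‖ ≤ K * (1 + ‖x - m‖))
    (hmin : ∀ (m' : Vec d) (S' : Mat d), S'.PosDef → freeEnergy U m S ≤ freeEnergy U m' S')
    (v : Vec d) (H : Mat d) :
    ∫ x, fderiv ℝ U x (v + matVec H (x - m)) ∂(gaussian m S) = H.trace := by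
  set c := (2 * π * Real.exp 1) ^ d
  have hcpos : 0 < c := by positivity
  have hcomp := (continuous_matVec H).comp (continuous_sub_right m)
  have hint := hasDerivAt_integral_gaussian hU hS hK
    (C := ‖v‖ + ‖Matrix.toEuclideanCLM (𝕜 := ℝ) H‖) (by positivity) hgrad
    (w := fun x => v + matVec H (x - m)) (continuous_const.add hcomp) fun x => by
      refine (norm_add_le _ _).trans ?_
      have h1 := (Matrix.toEuclideanCLM (𝕜 := ℝ) H).le_opNorm (x - m)
      rw [← matVec_eq_toEuclideanCLM] at h1
      have h2 : 0 ≤ ‖v‖ * ‖x - m‖ := by positivity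
      have h3 := norm_nonneg (Matrix.toEuclideanCLM (𝕜 := ℝ) H)
      linarith
  have hdet := hasDerivAt_det_one_add_smul H
  have hlog : HasDerivAt (fun t : ℝ => Real.log (c * ((1 + t • H).det ^ 2 * S.det)))
      (2 * H.trace) 0 := by
    have h := (((hdet.pow 2).mul_const S.det).const_mul c).log
      (by simpa using ⟨hcpos.ne', hS.det_pos.ne'⟩)
    refine h.congr_deriv ?_
    have := hS.det_pos.ne'
    simp
    field_simp
  have hderiv := hint.sub (hlog.const_mul (1 / 2))
  have hloc : IsLocalMin (fun t : ℝ => (∫ x, U (x + t • (v + matVec H (x - m))) ∂(gaussian m S))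
      - 1 / 2 * Real.log (c * ((1 + t • H).det ^ 2 * S.det))) 0 := by
    have hev : ∀ᶠ t : ℝ in nhds 0, (1 + t • H).det ≠ 0 :=
      hdet.continuousAt.eventually_ne (by simp)
    filter_upwards [hev] with t ht
    have hpos : ((1 + t • H) * S * (1 + t • H)ᵀ).PosDef := by
      refine hS.mul_mul_conjTranspose_same (B := 1 + t • H) ?_
      exact Matrix.vecMul_injective_of_isUnit ((Matrix.isUnit_iff_isUnit_det _).2 ht.isUnit)
    have h := hmin (m + t • v) _ hpos
    unfold freeEnergy at h
    rw [integral_gaussian_affine m _ S ht] at h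
    have hpt (x : Vec d) : m + t • v + matVec (1 + t • H) (x - m)
        = x + t • (v + matVec H (x - m)) := by
      simp only [matVec_eq_toEuclideanCLM, map_add, map_smul, map_one,
        _root_.add_apply, _root_.smul_apply,
        one_apply_eq_self, smul_add]
      abel
    have hdt : ((1 + t • H) * S * (1 + t • H)ᵀ).det = (1 + t • H).det ^ 2 * S.det := by
      rw [Matrix.det_mul, Matrix.det_mul, Matrix.det_transpose]
      ring
    simp only [hpt, hdt] at h
    simpa using h
  have := hloc.hasDerivAt_eq_zero hderiv
  linarith

lemma hasFDerivAt_gaussianDensity (m : Vec d) {S : Mat d} (hS : S.PosDef) (x : Vec d) :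
    HasFDerivAt (gaussianDensity m S)
      (-gaussianDensity m S x • innerSL ℝ (matVec S⁻¹ (x - m))) x := by
  set A := Matrix.toEuclideanCLM (𝕜 := ℝ) S⁻¹
  have hsub : HasFDerivAt (fun y : Vec d => y - m) (ContinuousLinearMap.id ℝ (Vec d)) x :=
    (hasFDerivAt_id x).sub_const m
  have hsymm (u v : Vec d) : ⟪u, A v⟫ = ⟪v, A u⟫ := by
    have hT : (S⁻¹)ᵀ = S⁻¹ := by simpa using hS.inv.isHermitian.eq
    rw [Matrix.inner_toEuclideanCLM, Matrix.inner_toEuclideanCLM, Matrix.dotProduct_mulVec,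
      ← Matrix.mulVec_transpose, hT, dotProduct_comm]
  have hquad : HasFDerivAt (fun y => -⟪y - m, A (y - m)⟫ / 2) (-innerSL ℝ (A (x - m))) x := by
    have h := ((hsub.inner ℝ (A.hasFDerivAt.comp x hsub)).neg).mul_const (2⁻¹ : ℝ)
    refine h.congr_fderiv ?_
    ext v
    simp [fderivInnerCLM_apply, hsymm (x - m) v, inner_sub_right, real_inner_comm v]
    ring
  refine (hquad.exp.const_mul (√(((2 * π) ^ d * S.det)⁻¹))).congr_fderiv ?_
  ext v
  simp [gaussianDensity, matVec_eq_toEuclideanCLM, A]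
  ring

/-- Stein's identity for a multivariate Gaussian. -/
lemma integral_gaussian_fderiv_eq {g : Vec d → ℝ} (hg : ContDiff ℝ 1 g) {m : Vec d} {S : Mat d}
    (hS : S.PosDef) {K K' : ℝ} (hK : 0 ≤ K) (hgK : ∀ x, ‖g x‖ ≤ K * (1 + ‖x - m‖))
    (hgK' : ∀ x, ‖fderiv ℝ g x‖ ≤ K' * (1 + ‖x - m‖ ^ 2)) (v : Vec d) :
    ∫ x, fderiv ℝ g x v ∂(gaussian m S) =
      ∫ x, g x * ⟪matVec S⁻¹ (x - m), v⟫ ∂(gaussian m S) := by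
  have hlin : Continuous fun x => ⟪matVec S⁻¹ (x - m), v⟫ :=
    ((continuous_matVec S⁻¹).comp (continuous_sub_right m)).inner continuous_const
  have hρ (x : Vec d) : fderiv ℝ (gaussianDensity m S) x v =
      -(gaussianDensity m S x * ⟪matVec S⁻¹ (x - m), v⟫) := by
    rw [(hasFDerivAt_gaussianDensity m hS x).fderiv]
    simp
  have hint : Integrable fun x => gaussianDensity m S x • g x := by
    refine integrable_gaussianDensity_smul hS hg.continuous (K := 2 * K) fun x => ?_
    nlinarith [hgK x, mul_nonneg hK (sq_nonneg (‖x - m‖ - 1)), mul_nonneg hK (sq_nonneg ‖x - m‖)]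
  have hint_fderiv : Integrable fun x => gaussianDensity m S x • fderiv ℝ g x v := by
    refine integrable_gaussianDensity_smul hS
      ((hg.continuous_fderiv (by norm_num)).clm_apply continuous_const) (K := K' * ‖v‖) fun x => ?_
    refine (ContinuousLinearMap.le_opNorm _ v).trans ?_
    rw [mul_right_comm]
    exact mul_le_mul_of_nonneg_right (hgK' x) (norm_nonneg v)
  have hint_mul :
      Integrable fun x => gaussianDensity m S x • (g x * ⟪matVec S⁻¹ (x - m), v⟫) := by
    set A := Matrix.toEuclideanCLM (𝕜 := ℝ) S⁻¹
    refine integrable_gaussianDensity_smul hS (hg.continuous.mul hlin)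
      (K := 2 * K * (‖A‖ * ‖v‖)) fun x => ?_
    have h1 : ‖⟪matVec S⁻¹ (x - m), v⟫‖ ≤ ‖A‖ * ‖x - m‖ * ‖v‖ :=
      (norm_inner_le_norm _ _).trans
        (mul_le_mul_of_nonneg_right (A.le_opNorm (x - m)) (norm_nonneg v))
    calc ‖g x * ⟪matVec S⁻¹ (x - m), v⟫‖
        ≤ (K * (1 + ‖x - m‖)) * (‖A‖ * ‖x - m‖ * ‖v‖) := by
          rw [norm_mul]
          exact mul_le_mul (hgK x) h1 (norm_nonneg _) (by positivity)
      _ = K * (‖A‖ * ‖v‖) * ((1 + ‖x - m‖) * ‖x - m‖) := by ring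
      _ ≤ K * (‖A‖ * ‖v‖) * (2 * (1 + ‖x - m‖ ^ 2)) := by
          refine mul_le_mul_of_nonneg_left ?_ (by positivity)
          nlinarith [sq_nonneg (‖x - m‖ - 1)]
      _ = _ := by ring
  have key := integral_mul_fderiv_eq_neg_fderiv_mul_of_integrable
    (μ := (volume : Measure (Vec d))) (f := g) (g := gaussianDensity m S) (v := v)
    (hint_fderiv.congr (.of_forall fun x => by simp [mul_comm]))
    (hint_mul.neg.congr (.of_forall fun x => by simp [hρ]; ring))
    (hint.congr (.of_forall fun x => by simp [mul_comm]))
    (fun x _ => hg.differentiable (by norm_num) x)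
    (fun x _ => (hasFDerivAt_gaussianDensity m hS x).differentiableAt)
  simp only [integral_gaussian_eq_integral_density, smul_eq_mul]
  simp only [hρ, mul_neg, integral_neg, neg_inj] at key
  simp only [mul_comm (gaussianDensity m S _)] at key ⊢
  rw [← key]
  refine integral_congr_ae (.of_forall fun x => ?_)
  ring

/-- **Stationarity conditions for the free-energy minimizer over Gaussians.**
If `(m_*, Σ_*)` minimizes the free energy over all means and positive-definite
covariances, then `∫ ∇U dN(m_*,Σ_*) = 0` and `∫ ∇²U dN(m_*,Σ_*) = Σ_*⁻¹`. -/
theorem stationarity_conditions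
    (d : ℕ) (hd : 0 < d) (U : Vec d → ℝ) (μ L : ℝ) (hμ : 0 < μ) (hμL : μ ≤ L)
    (hU : ContDiff ℝ 2 U)
    (hconv : ∀ x : Vec d,
      (hess U x - μ • 1).PosSemidef ∧ ((L • (1 : Mat d)) - hess U x).PosSemidef)
    (mstar : Vec d) (Sstar : Mat d) (hSstar : Sstar.PosDef)
    (hmin : ∀ (m : Vec d) (S : Mat d), S.PosDef →
      freeEnergy U mstar Sstar ≤ freeEnergy U m S) :
    intGrad U (gaussian mstar Sstar) = 0 ∧
      intHess U (gaussian mstar Sstar) = Sstar⁻¹ := by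
  have hess_le (x : Vec d) (i j : Fin d) : |hess U x i j| ≤ L :=
    abs_apply_le_of_loewner_bounds hμ.le (hconv x).1 (hconv x).2 i j
  obtain ⟨K, hK, hgrad⟩ := exists_norm_fderiv_le hU hess_le mstar
  have hU1 : ContDiff ℝ 1 U := hU.of_le (by norm_num)
  have hstat := integral_fderiv_affine_eq_trace hU1 hSstar hK hgrad hmin
  constructor
  · have hnorm (x : Vec d) : ‖gradient U x‖ = ‖fderiv ℝ U x‖ := by simp [gradient]
    have hcont : Continuous (gradient U) :=
      (InnerProductSpace.toDual ℝ (Vec d)).symm.continuous.comp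
        (hU1.continuous_fderiv (by norm_num))
    have hint := integrable_gaussianDensity_smul hSstar hcont (K := 2 * K) (m := mstar) fun x => by
      rw [hnorm]
      nlinarith [hgrad x, mul_nonneg hK (sq_nonneg (‖x - mstar‖ - 1)),
        mul_nonneg hK (sq_nonneg ‖x - mstar‖)]
    refine ext_inner_left ℝ fun v => ?_
    have h := hstat v 0
    rw [integral_gaussian_eq_integral_density, Matrix.trace_zero] at h
    rw [intGrad, integral_gaussian_eq_integral_density, ← integral_inner hint, inner_zero_right,
      ← h]
    refine integral_congr_ae (.of_forall fun x => ?_)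
    simp only [inner_smul_right, matVec_eq_toEuclideanCLM, map_zero, _root_.zero_apply, add_zero,
      smul_eq_mul]
    rw [real_inner_comm, inner_gradient_left]
  · ext i j
    have hL : 0 ≤ L := hμ.le.trans hμL
    have hstein := integral_gaussian_fderiv_eq (contDiff_fderiv_apply hU (EuclideanSpace.single j 1))
      hSstar hK (m := mstar) (K' := d * L) (fun x => by
        simpa using (fderiv ℝ U x).le_of_opNorm_le (hgrad x) (EuclideanSpace.single j 1))
      (fun x => (opNorm_le_of_apply_single_le hL fun k => hess_le x k j).trans
        (le_mul_of_one_le_right (by positivity) (by simp)))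
      (EuclideanSpace.single i 1)
    have h := hstat 0 (Matrix.single j i 1 * Sstar⁻¹)
    have hmul (x : Vec d) : matVec (Matrix.single j i 1 * Sstar⁻¹) x =
        ⟪matVec Sstar⁻¹ x, EuclideanSpace.single i 1⟫ • EuclideanSpace.single j (1 : ℝ) := by
      rw [matVec_mul]
      ext k
      change (Matrix.single j i 1 *ᵥ (matVec Sstar⁻¹ x).ofLp) k = _
      simp [Matrix.single_mulVec, EuclideanSpace.inner_single_right,
        Function.update_apply]
    simp only [hmul, zero_add, map_smul, smul_eq_mul, mul_comm ⟪_, _⟫] at h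
    change ∫ x, hess U x i j ∂(gaussian mstar Sstar) = _
    refine (hstein.trans h).trans ?_
    simp [Matrix.trace_single_mul]
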